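/- Let (t_n) be the Thue–Morse sequence over F_2 and let R = Σ_{i≥1} t_{i−1} x^{-i} ∈ F_2((x^{-1})). R is irrational, so its continued fraction expansion R = A_0 + 1/(A_1 + 1/(A_2 + …)) with partial quotients A_j ∈ F_2[x] is well defined via A_0 = Pol(R), B_0 = R − A_0, A_{j+1} = Pol(B_j^{-1}), B_{j+1} = B_j^{-1} − A_{j+1}. Then A_1 = x^2 + x + 1 and A_j = x^2 + 1 for all j ≥ 2. -/

import Mathlib

noncomputable section

/-- The element `x` of `F₂((x⁻¹))`: the field of formal Laurent series in `x⁻¹` is modelled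
as `LaurentSeries (ZMod 2)` whose variable represents `x⁻¹`, so `x` is its inverse.
The coefficient of `x^{-i}` of an element `R` is then `R.coeff i`. -/
def xVar : LaurentSeries (ZMod 2) :=
  ((PowerSeries.X : PowerSeries (ZMod 2)) : LaurentSeries (ZMod 2))⁻¹

/-- The embedding of `F₂[x]` into `F₂((x⁻¹))`. -/
def polyToLaurent (P : Polynomial (ZMod 2)) : LaurentSeries (ZMod 2) :=
  Polynomial.aeval xVar P

/-- The polynomial part `Pol(R) ∈ F₂[x]` of `R = ∑_{i ≥ -m} r_i x^{-i}`, i.e.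
`∑_{i = -m}^{0} r_i x^{-i}`, viewed as a polynomial in `x`. -/
def polPart (R : LaurentSeries (ZMod 2)) : Polynomial (ZMod 2) :=
  ∑ j ∈ Finset.range ((-R.order).toNat + 1),
    Polynomial.C (R.coeff (-(j : ℤ))) * Polynomial.X ^ j

/-- The remainders in the continued fraction algorithm:
`B₀ = R - Pol(R)`, `B_{j+1} = B_j⁻¹ - Pol(B_j⁻¹)`. -/
def cfB (R : LaurentSeries (ZMod 2)) : ℕ → LaurentSeries (ZMod 2)
  | 0 => R - polyToLaurent (polPart R)
  | j + 1 => (cfB R j)⁻¹ - polyToLaurent (polPart ((cfB R j)⁻¹))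

/-- The partial quotients of the continued fraction expansion:
`A₀ = Pol(R)`, `A_{j+1} = Pol(B_j⁻¹)`. -/
def cfA (R : LaurentSeries (ZMod 2)) : ℕ → Polynomial (ZMod 2)
  | 0 => polPart R
  | j + 1 => polPart ((cfB R j)⁻¹)

theorem xVar_eq_single : xVar = HahnSeries.single (-1 : ℤ) (1 : ZMod 2) := by
  simp [xVar, HahnSeries.ofPowerSeries_X]

theorem coeff_neg_polyToLaurent (P : Polynomial (ZMod 2)) (n : ℕ) :
    (polyToLaurent P).coeff (-(n : ℤ)) = P.coeff n := by
  induction P using Polynomial.induction_on' with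
  | add p q hp hq =>
    rw [polyToLaurent, map_add, HahnSeries.coeff_add, Polynomial.coeff_add, ← hp, ← hq]
    rfl
  | monomial k a =>
    rw [polyToLaurent, Polynomial.aeval_monomial, xVar_eq_single, HahnSeries.single_pow, one_pow,
      HahnSeries.algebraMap_apply', PowerSeries.algebraMap_apply, Algebra.algebraMap_self_apply,
      HahnSeries.ofPowerSeries_C, HahnSeries.C_mul_eq_smul, HahnSeries.coeff_smul,
      HahnSeries.coeff_single, Polynomial.coeff_monomial]
    simp [eq_comm]

theorem polyToLaurent_injective : Function.Injective polyToLaurent := fun P Q h => by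
  ext n
  rw [← coeff_neg_polyToLaurent, h, coeff_neg_polyToLaurent]

theorem coeff_polPart (R : LaurentSeries (ZMod 2)) (n : ℕ) :
    (polPart R).coeff n = R.coeff (-(n : ℤ)) := by
  simp only [polPart, Polynomial.finsetSum_coeff, Polynomial.coeff_C_mul_X_pow]
  rw [Finset.sum_ite_eq]
  split_ifs with h
  · rfl
  · rw [HahnSeries.coeff_eq_zero_of_lt_order]
    rw [Finset.mem_range] at h
    omega

theorem polPart_polyToLaurent_add (P : Polynomial (ZMod 2)) (F : PowerSeries (ZMod 2)) :
    polPart (polyToLaurent P + ((PowerSeries.X * F : PowerSeries (ZMod 2)) :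
      LaurentSeries (ZMod 2))) = P := by
  ext n
  rw [coeff_polPart, HahnSeries.coeff_add, coeff_neg_polyToLaurent, PowerSeries.coeff_coe]
  rcases n with _ | n
  · simp
  · rw [if_pos (by omega), add_zero]

theorem polPart_X_mul (F : PowerSeries (ZMod 2)) :
    polPart ((PowerSeries.X * F : PowerSeries (ZMod 2)) : LaurentSeries (ZMod 2)) = 0 := by
  simpa [polyToLaurent] using polPart_polyToLaurent_add 0 F

instance : CharP (PowerSeries (ZMod 2)) 2 :=
  charP_of_injective_ringHom PowerSeries.C_injective 2

instance : CharP (LaurentSeries (ZMod 2)) 2 :=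
  charP_of_injective_ringHom (HahnSeries.ofPowerSeries_injective (Γ := ℤ) (R := ZMod 2)) 2

theorem PowerSeries.expand_two_eq_sq (f : PowerSeries (ZMod 2)) :
    PowerSeries.expand 2 two_ne_zero f = f ^ 2 := by
  have h := MvPowerSeries.map_frobenius_expand 2 two_ne_zero (f := f)
  rw [ZMod.frobenius_zmod] at h
  rw [← h]
  simp [PowerSeries.expand]

theorem thueMorse_quadratic (t : ℕ → ZMod 2)
    (he : ∀ n, t (2 * n) = t n) (ho : ∀ n, t (2 * n + 1) = t n + 1) :
    (1 + PowerSeries.X) ^ 2 * PowerSeries.mk t =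
      (1 + PowerSeries.X) ^ 3 * PowerSeries.mk t ^ 2 + PowerSeries.X := by
  set H : PowerSeries (ZMod 2) := PowerSeries.expand 2 two_ne_zero (PowerSeries.mk fun _ => 1)
    with hH
  have hH1 : (1 + PowerSeries.X) ^ 2 * H = 1 := by
    have := PowerSeries.mk_one_mul_one_sub_eq_one (ZMod 2)
    rw [CharTwo.sub_eq_add, mul_comm] at this
    rw [hH, ← PowerSeries.expand_two_eq_sq, ← map_mul]
    exact (congrArg _ this).trans (map_one _)
  have hT : PowerSeries.mk t =
      PowerSeries.mk t ^ 2 + PowerSeries.X * (PowerSeries.mk t ^ 2 + H) := by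
    rw [← PowerSeries.expand_two_eq_sq, hH, ← map_add]
    ext n
    rcases Nat.even_or_odd' n with ⟨k, rfl | rfl⟩
    · rw [map_add, PowerSeries.coeff_expand_mul, PowerSeries.coeff_mk, PowerSeries.coeff_mk, he]
      rcases k with _ | k
      · simp
      · rw [show 2 * (k + 1) = 2 * k + 1 + 1 by ring, PowerSeries.coeff_succ_X_mul,
          PowerSeries.coeff_expand_of_not_dvd _ _ _ (by omega), add_zero]
    · rw [map_add, PowerSeries.coeff_succ_X_mul, PowerSeries.coeff_expand_mul,
        PowerSeries.coeff_expand_of_not_dvd _ _ _ (by omega)]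
      simp [ho]
  linear_combination (1 + PowerSeries.X) ^ 2 * hT + PowerSeries.X * hH1

/-- A root `ε` of `ε² + (x² + 1) ε + 1` satisfies `ε⁻¹ = x² + 1 + ε`. -/
theorem inv_eq_of_quadratic {ε : LaurentSeries (ZMod 2)}
    (hq : ε ^ 2 + (xVar ^ 2 + 1) * ε + 1 = 0) :
    ε⁻¹ = polyToLaurent (Polynomial.X ^ 2 + 1) + ε := by
  have h2 : (2 : LaurentSeries (ZMod 2)) = 0 := CharTwo.two_eq_zero
  apply inv_eq_of_mul_eq_one_right
  simp only [polyToLaurent, map_add, map_pow, map_one, Polynomial.aeval_X]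
  linear_combination hq - h2

/-- The polynomial `Y² + (x² + 1) Y + 1` has no root in `F₂(x)`. -/
theorem quadratic_no_rational_root {f g : Polynomial (ZMod 2)} (hg : g ≠ 0) :
    f ^ 2 + (Polynomial.X ^ 2 + 1) * f * g + g ^ 2 ≠ 0 := by
  intro h
  have h2 : (2 : Polynomial (ZMod 2)) = 0 := CharTwo.two_eq_zero
  obtain ⟨d, f', g', hfg, rfl, rfl⟩ :
      ∃ d f' g' : Polynomial (ZMod 2), IsCoprime f' g' ∧ f = d * f' ∧ g = d * g' := by
    have hgcd : EuclideanDomain.gcd f g ≠ 0 := fun h' => hg (EuclideanDomain.gcd_eq_zero_iff.1 h').2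
    obtain ⟨f', hf'⟩ := EuclideanDomain.gcd_dvd_left f g
    obtain ⟨g', hg'⟩ := EuclideanDomain.gcd_dvd_right f g
    refine ⟨_, f', g', ⟨EuclideanDomain.gcdA f g, EuclideanDomain.gcdB f g, ?_⟩, hf', hg'⟩
    apply mul_left_cancel₀ hgcd
    have := EuclideanDomain.gcd_eq_gcd_ab f g
    linear_combination EuclideanDomain.gcdA f g * (-hf') + EuclideanDomain.gcdB f g * (-hg') - this
  have hd : d ^ 2 ≠ 0 := pow_ne_zero 2 (left_ne_zero_of_mul hg)
  have h' : f' ^ 2 + (Polynomial.X ^ 2 + 1) * f' * g' + g' ^ 2 = 0 := by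
    apply mul_left_cancel₀ hd
    linear_combination h
  have eq_one {p : Polynomial (ZMod 2)} (hp : IsUnit p) : p = 1 := by
    obtain ⟨r, hr, rfl⟩ := Polynomial.isUnit_iff.1 hp
    have : ∀ r : ZMod 2, IsUnit r → r = 1 := by
      decide
    rw [this r hr, map_one]
  have hf1 : f' = 1 := eq_one <| (hfg.pow_right (n := 2)).isUnit_of_dvd'
    dvd_rfl ⟨f' + (Polynomial.X ^ 2 + 1) * g', by linear_combination - h' + g' ^ 2 * h2⟩
  have hg1 : g' = 1 := eq_one <| (hfg.pow_left (m := 2)).isUnit_of_dvd'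
    ⟨g' + (Polynomial.X ^ 2 + 1) * f', by linear_combination - h' + f' ^ 2 * h2⟩ dvd_rfl
  rw [hf1, hg1] at h'
  simpa [Polynomial.coeff_one] using congrArg (Polynomial.coeff · 2) h'

/-- For the Thue–Morse series `R`, the inverse is `x² + x + 1 + ε` with `ε` a power series in
`x⁻¹` without constant term which is a root of `Y² + (x² + 1) Y + 1`. -/
theorem exists_thueMorse_inv_eq (t : ℕ → ZMod 2) (h0 : t 0 = 0)
    (he : ∀ n, t (2 * n) = t n) (ho : ∀ n, t (2 * n + 1) = t n + 1)
    (R : LaurentSeries (ZMod 2))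
    (hR : R = ((PowerSeries.X * PowerSeries.mk t : PowerSeries (ZMod 2)) :
      LaurentSeries (ZMod 2))) :
    ∃ (F : PowerSeries (ZMod 2)) (ε : LaurentSeries (ZMod 2)),
      ε = ((PowerSeries.X * F : PowerSeries (ZMod 2)) : LaurentSeries (ZMod 2)) ∧
      R⁻¹ = polyToLaurent (Polynomial.X ^ 2 + Polynomial.X + 1) + ε ∧
      ε ^ 2 + (xVar ^ 2 + 1) * ε + 1 = 0 := by
  have h2 : (2 : LaurentSeries (ZMod 2)) = 0 := CharTwo.two_eq_zero
  have t1 : t 1 = 1 := by simpa [h0] using ho 0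
  have t2 : t 2 = 1 := by simpa [t1] using he 1
  have t3 : t 3 = 0 := by simpa [t1, CharTwo.add_self_eq_zero] using ho 1
  set W : PowerSeries (ZMod 2) := PowerSeries.mk fun n => t (n + 1) with hW
  have hTW : PowerSeries.mk t = PowerSeries.X * W := by
    ext n
    rcases n with _ | n <;> simp [hW, h0]
  have hW0 : PowerSeries.constantCoeff W = 1 := by
    rw [← PowerSeries.coeff_zero_eq_constantCoeff_apply, hW, PowerSeries.coeff_mk, t1]
  have hWi : W * W⁻¹ = 1 := PowerSeries.mul_inv_cancel _ (by simp [hW0])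
  obtain ⟨G, hG⟩ : PowerSeries.X ^ 3 ∣ 1 - (1 + PowerSeries.X + PowerSeries.X ^ 2) * W := by
    rw [PowerSeries.X_pow_dvd_iff]
    intro m hm
    have e : 1 - (1 + PowerSeries.X + PowerSeries.X ^ 2) * W =
      1 - (W + PowerSeries.X * W + PowerSeries.X * (PowerSeries.X * W)) := by ring
    rw [e]
    interval_cases m
    · simp [hW0]
    · rw [map_sub, map_add, map_add, PowerSeries.coeff_succ_X_mul, PowerSeries.coeff_succ_X_mul,
        PowerSeries.coeff_zero_X_mul, hW]
      simp [t1, t2, PowerSeries.coeff_one, CharTwo.add_self_eq_zero]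
    · rw [map_sub, map_add, map_add, PowerSeries.coeff_succ_X_mul, PowerSeries.coeff_succ_X_mul,
        PowerSeries.coeff_succ_X_mul, hW]
      simp [t1, t2, t3, PowerSeries.coeff_one, CharTwo.add_self_eq_zero]
  have hquad := congrArg (HahnSeries.ofPowerSeries ℤ (ZMod 2)) (thueMorse_quadratic t he ho)
  have hG' := congrArg (HahnSeries.ofPowerSeries ℤ (ZMod 2)) hG
  have hWi' := congrArg (HahnSeries.ofPowerSeries ℤ (ZMod 2)) hWi
  rw [hTW] at hquad hR
  simp only [map_mul, map_add, map_pow, map_one, map_sub] at hquad hG' hWi' hR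
  set z : LaurentSeries (ZMod 2) := ((PowerSeries.X : PowerSeries (ZMod 2)) : LaurentSeries (ZMod 2))
    with hz
  set w : LaurentSeries (ZMod 2) := (W : LaurentSeries (ZMod 2))
  have hx : xVar = z⁻¹ := rfl
  have hz0 : z ≠ 0 := by simp [hz, HahnSeries.ofPowerSeries_X]
  have hw0 : w ≠ 0 := left_ne_zero_of_mul_eq_one hWi'
  have hinv : R⁻¹ = polyToLaurent (Polynomial.X ^ 2 + Polynomial.X + 1) +
      ((PowerSeries.X * (G * W⁻¹) : PowerSeries (ZMod 2)) : LaurentSeries (ZMod 2)) := by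
    simp only [polyToLaurent, map_add, map_mul, map_pow, map_one, Polynomial.aeval_X, hx, hR,
      eq_inv_of_mul_eq_one_right hWi', ← hz]
    field_simp
    linear_combination hG'
  refine ⟨G * W⁻¹, _, rfl, hinv, ?_⟩
  rw [← sub_eq_iff_eq_add'.2 hinv]
  simp only [polyToLaurent, map_add, map_pow, map_one, Polynomial.aeval_X, hx, hR]
  have hquad' : (1 + z) ^ 2 * w = (1 + z) ^ 3 * z * w ^ 2 + 1 := by
    apply mul_left_cancel₀ hz0
    linear_combination hquad
  field_simp
  linear_combination hquad' +
    (1 - w * (1 + 2 * z + z ^ 2) + w ^ 2 * (z + 2 * z ^ 2 + 2 * z ^ 3 + z ^ 4)) * h2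

/-- For the Thue–Morse sequence `t`, the Laurent series `R = ∑_{i ≥ 1} t_{i-1} x^{-i}` is
irrational, and its continued fraction expansion has partial quotients `A₁ = x² + x + 1`
and `A_j = x² + 1` for all `j ≥ 2`. -/
theorem thueMorse_continuedFraction (t : ℕ → ZMod 2) (h0 : t 0 = 0)
    (he : ∀ n, t (2 * n) = t n) (ho : ∀ n, t (2 * n + 1) = t n + 1)
    (R : LaurentSeries (ZMod 2))
    (hR : R = ((PowerSeries.X * PowerSeries.mk t : PowerSeries (ZMod 2)) :
      LaurentSeries (ZMod 2))) :
    (¬ ∃ f g : Polynomial (ZMod 2), g ≠ 0 ∧ polyToLaurent g * R = polyToLaurent f) ∧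
    cfA R 1 = Polynomial.X ^ 2 + Polynomial.X + 1 ∧
    ∀ j, 2 ≤ j → cfA R j = Polynomial.X ^ 2 + 1 := by
  obtain ⟨F, ε, hF, hinv, hq⟩ := exists_thueMorse_inv_eq t h0 he ho R hR
  have hB0 : cfB R 0 = R := by
    rw [cfB, hR, polPart_X_mul]
    simp [polyToLaurent]
  have hA1 : polPart R⁻¹ = Polynomial.X ^ 2 + Polynomial.X + 1 := by
    rw [hinv, hF, polPart_polyToLaurent_add]
  have hAε : polPart ε⁻¹ = Polynomial.X ^ 2 + 1 := by
    rw [inv_eq_of_quadratic hq, hF, polPart_polyToLaurent_add]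
  have hB (j : ℕ) : cfB R (j + 1) = ε := by
    induction j with
    | zero => rw [cfB, hB0, hA1, hinv, add_sub_cancel_left]
    | succ j ih => rw [cfB, ih, hAε, inv_eq_of_quadratic hq, add_sub_cancel_left]
  refine ⟨?_, ?_, ?_⟩
  · rintro ⟨f, g, hg, hfg⟩
    have hR0 : R ≠ 0 := by
      rintro rfl
      have := congrArg (Polynomial.coeff · 2) hA1
      simp [coeff_polPart, Polynomial.coeff_one, Polynomial.coeff_X] at this
    have hg0 : polyToLaurent g ≠ 0 := fun h => hg <| polyToLaurent_injective <| by
      simpa [polyToLaurent] using h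
    have hf : f ≠ 0 := by
      rintro rfl
      exact mul_ne_zero hg0 hR0 (by simpa [polyToLaurent] using hfg)
    refine quadratic_no_rational_root (f := g - (Polynomial.X ^ 2 + Polynomial.X + 1) * f) hf
      (polyToLaurent_injective ?_)
    have key : polyToLaurent f * ε =
        polyToLaurent (g - (Polynomial.X ^ 2 + Polynomial.X + 1) * f) := by
      have h1 : polyToLaurent f * R⁻¹ = polyToLaurent g := by
        rw [← hfg, mul_inv_cancel_right₀ hR0]
      rw [hinv] at h1
      simp only [polyToLaurent, map_add, map_pow, map_one, map_sub, map_mul,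
        Polynomial.aeval_X] at h1 ⊢
      linear_combination h1
    generalize g - (Polynomial.X ^ 2 + Polynomial.X + 1) * f = u at key
    simp only [polyToLaurent, map_add, map_pow, map_one, map_zero, map_mul,
      Polynomial.aeval_X] at key ⊢
    rw [← key]
    linear_combination Polynomial.aeval xVar f ^ 2 * hq
  · rw [cfA, hB0, hA1]
  · intro j hj
    obtain ⟨k, rfl⟩ := Nat.exists_eq_add_of_le' hj
    rw [cfA, hB, hAε]
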